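/- For the rectangle R_{a,b} = (-b/2, b/2) × (-a/2, a/2) with 0 < a ≤ b, the torsional rigidity satisfies T(R_{a,b}) ≥ a³b/12 - 11a⁴/180. -/

import Mathlib

open MeasureTheory Metric Set

/-- The torsional rigidity of `Ω`: `T(Ω) = -2 E₁(Ω)` where
`E₁(Ω) = inf { ∫ (|∇u|²/2 - u) : u ∈ H¹₀(Ω) }`, realized via `C¹` functions compactly
supported in `Ω`. -/
noncomputable def torsionalRigidity {E : Type*} [NormedAddCommGroup E] [NormedSpace ℝ E]
    [MeasureSpace E] (Ω : Set E) : ℝ :=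
  -2 * sInf {r : ℝ | ∃ u : E → ℝ, ContDiff ℝ 1 u ∧ HasCompactSupport u ∧ tsupport u ⊆ Ω ∧
    r = ∫ x, (‖fderiv ℝ u x‖ ^ 2 / 2 - u x)}

lemma aux_phi (δ : ℝ) (hδ : 0 < δ) : ∃ φ ψ : ℝ → ℝ, Continuous ψ ∧ (∀ t, HasDerivAt φ (ψ t) t) ∧
    (∀ t, t ≤ δ → φ t = 0) ∧ (∀ t, t ≤ δ → ψ t = 0) ∧ (∀ t, 0 ≤ ψ t) ∧ (∀ t, ψ t ≤ 1) ∧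
    (∀ t, 0 ≤ φ t) ∧ (∀ t, 0 ≤ t → φ t ≤ t) ∧ (∀ t, t - 2 * δ ≤ φ t) := by
  let ψ : ℝ → ℝ := fun s => max 0 (min 1 ((s - δ) / δ))
  have hc : Continuous ψ := by fun_prop
  have h0 : ∀ t, 0 ≤ ψ t := fun t => le_max_left _ _
  have h1 : ∀ t, ψ t ≤ 1 := fun t => max_le zero_le_one (min_le_left _ _)
  have hz : ∀ t, t ≤ δ → ψ t = 0 := by
    intro t ht
    apply max_eq_left
    refine (min_le_right _ _).trans ?_
    exact div_nonpos_of_nonpos_of_nonneg (by linarith) hδ.le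
  have hone : ∀ t, 2 * δ ≤ t → ψ t = 1 := by
    intro t ht
    have : 1 ≤ (t - δ) / δ := by rw [le_div_iff₀ hδ]; linarith
    simp [ψ, this]
  have hi : ∀ a b, IntervalIntegrable ψ volume a b := fun a b => hc.intervalIntegrable a b
  have hφz : ∀ t, t ≤ δ → ∫ s in δ..t, ψ s = 0 := by
    intro t ht
    rw [intervalIntegral.integral_congr (g := fun _ => 0)]
    · simp
    · intro s hs
      rw [uIcc_of_ge ht] at hs
      exact hz s hs.2
  have hφ0 : ∀ t, 0 ≤ ∫ s in δ..t, ψ s := by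
    intro t
    rcases le_total t δ with h | h
    · rw [hφz t h]
    · exact intervalIntegral.integral_nonneg h fun s _ => h0 s
  refine ⟨fun t => ∫ s in δ..t, ψ s, ψ, hc, ?_, hφz, hz, h0, h1, hφ0, ?_, ?_⟩
  · intro t
    exact (hc.integral_hasStrictDerivAt δ t).hasDerivAt
  · intro t ht
    rcases le_total t δ with h | h
    · simpa [hφz t h] using ht
    · have := intervalIntegral.integral_mono_on h (hi δ t) (g := fun _ => (1:ℝ))
        (by simp) (fun s _ => h1 s)
      simp at this
      simp only
      linarith
  · intro t
    rcases le_total t (2 * δ) with h | h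
    · have := hφ0 t
      simp only
      linarith
    · have h2 : ∫ s in (2*δ)..t, ψ s = t - 2 * δ := by
        rw [intervalIntegral.integral_congr (g := fun _ => 1)]
        · simp
        · intro s hs
          rw [uIcc_of_le h] at hs
          exact hone s hs.1
      have := intervalIntegral.integral_add_adjacent_intervals (hi δ (2*δ)) (hi (2*δ) t)
      have := hφ0 (2*δ)
      simp only
      linarith

lemma aux_cutoff (f f' : ℝ → ℝ) (L δ : ℝ) (hL : 0 < L) (hδ : 0 < δ)
    (hf : ∀ x, HasDerivAt f (f' x) x) (hf' : Continuous f')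
    (hin : ∀ x ∈ Icc (-L) L, 0 ≤ f x) (hout : ∀ x, x ∉ Ioo (-L) L → f x ≤ 0) :
    ∃ F F' : ℝ → ℝ, (∀ x, HasDerivAt F (F' x) x) ∧ Continuous F' ∧
      HasCompactSupport F ∧ HasCompactSupport F' ∧ tsupport F ⊆ Ioo (-L) L ∧
      (∫ x, F x ^ 2) ≤ ∫ x in (-L)..L, f x ^ 2 ∧
      (∫ x, F' x ^ 2) ≤ ∫ x in (-L)..L, f' x ^ 2 ∧
      (∫ x in (-L)..L, f x) - 4 * L * δ ≤ ∫ x, F x := by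
  obtain ⟨φ, ψ, hψc, hφd, hφz, hψz, hψ0, hψ1, hφ0, hφt, hφl⟩ := aux_phi δ hδ
  have hfc : Continuous f := continuous_iff_continuousAt.2 fun x => (hf x).continuousAt
  have hφc : Continuous φ := continuous_iff_continuousAt.2 fun x => (hφd x).continuousAt
  have hsub : ∀ G : ℝ → ℝ, (∀ x, f x ≤ δ → G x = 0) → tsupport G ⊆ Ioo (-L) L := by
    intro G hG
    have h1 : tsupport G ⊆ {x | δ ≤ f x} := by
      apply closure_minimal
      · intro x hx
        by_contra h
        exact hx (hG x (not_le.1 h).le)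
      · exact isClosed_le continuous_const hfc
    intro x hx
    by_contra h
    have := hout x h
    have : δ ≤ f x := h1 hx
    linarith
  have hcs : ∀ G : ℝ → ℝ, (∀ x, f x ≤ δ → G x = 0) → HasCompactSupport G := by
    intro G hG
    exact isCompact_Icc.of_isClosed_subset (isClosed_tsupport G)
      ((hsub G hG).trans Ioo_subset_Icc_self)
  have hint : ∀ G : ℝ → ℝ, (∀ x, f x ≤ δ → G x = 0) → ∫ x, G x = ∫ x in (-L)..L, G x := by
    intro G hG
    rw [intervalIntegral.integral_of_le (by linarith)]
    symm
    apply setIntegral_eq_integral_of_forall_compl_eq_zero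
    intro x hx
    apply hG
    have := hout x (fun h => hx ⟨h.1, h.2.le⟩)
    linarith
  have z1 : ∀ x, f x ≤ δ → φ (f x) = 0 := fun x h => hφz _ h
  have z2 : ∀ x, f x ≤ δ → ψ (f x) * f' x = 0 := fun x h => by simp [hψz _ h]
  refine ⟨fun x => φ (f x), fun x => ψ (f x) * f' x, fun x => (hφd _).comp x (hf x), by fun_prop,
    hcs _ z1, hcs _ z2, hsub _ z1, ?_, ?_, ?_⟩
  · rw [hint _ (fun x h => by simp [z1 x h])]
    apply intervalIntegral.integral_mono_on (by linarith)
    · exact Continuous.intervalIntegrable (by fun_prop) _ _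
    · exact Continuous.intervalIntegrable (by fun_prop) _ _
    · intro x hx
      exact pow_le_pow_left₀ (hφ0 _) (hφt _ (hin x hx)) 2
  · rw [hint _ (fun x h => by simp [z2 x h])]
    apply intervalIntegral.integral_mono_on (by linarith)
    · exact Continuous.intervalIntegrable (by fun_prop) _ _
    · exact Continuous.intervalIntegrable (by fun_prop) _ _
    · intro x hx
      rw [mul_pow]
      have := pow_le_one₀ (n := 2) (hψ0 (f x)) (hψ1 (f x))
      nlinarith [sq_nonneg (f' x)]
  · rw [hint _ z1]
    have : (∫ x in (-L)..L, f x) - 4 * L * δ = ∫ x in (-L)..L, (f x - 2 * δ) := by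
      rw [intervalIntegral.integral_sub (hfc.intervalIntegrable _ _) (by simp)]
      simp; ring
    rw [this]
    apply intervalIntegral.integral_mono_on (by linarith)
    · exact Continuous.intervalIntegrable (by fun_prop) _ _
    · exact Continuous.intervalIntegrable (by fun_prop) _ _
    · intro x hx
      exact hφl _

lemma aux_quad (a : ℝ) :
    (∫ y in (-(a/2))..(a/2), (a^2 - 4*y^2)/8) = a^3/12 ∧
    (∫ y in (-(a/2))..(a/2), ((a^2 - 4*y^2)/8)^2) = a^5/120 ∧
    (∫ y in (-(a/2))..(a/2), (-y)^2) = a^3/12 := by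
  have key : ∀ (g G : ℝ → ℝ), (∀ x, HasDerivAt G (g x) x) → Continuous g →
      ∫ y in (-(a/2))..(a/2), g y = G (a/2) - G (-(a/2)) := fun g G h hc =>
    intervalIntegral.integral_eq_sub_of_hasDerivAt (fun x _ => h x) (hc.intervalIntegrable _ _)
  refine ⟨?_, ?_, ?_⟩
  · rw [key _ (fun y => (a^2*y - 4*y^3/3)/8) ?_ (by fun_prop)]
    · ring
    · intro x
      convert! ((((hasDerivAt_id x).const_mul (a^2)).sub
        ((((hasDerivAt_id x).pow 3).const_mul 4).div_const 3)).div_const 8) using 1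
      simp; ring
  · rw [key _ (fun y => (a^4*y - 8*a^2*y^3/3 + 16*y^5/5)/64) ?_ (by fun_prop)]
    · ring
    · intro x
      convert! (((((hasDerivAt_id x).const_mul (a^4)).sub
        ((((hasDerivAt_id x).pow 3).const_mul (8*a^2)).div_const 3)).add
        ((((hasDerivAt_id x).pow 5).const_mul 16).div_const 5)).div_const 64) using 1
      simp; ring
  · rw [key _ (fun y => y^3/3) ?_ (by fun_prop)]
    · ring
    · intro x
      convert! ((hasDerivAt_id x).pow 3).div_const 3 using 1
      simp

lemma aux_cosh (k L : ℝ) (hk : 0 < k) (hL : 0 < L) :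
    ∃ t t' : ℝ → ℝ, (∀ x, HasDerivAt t (t' x) x) ∧ Continuous t' ∧
      (∀ x ∈ Icc (-L) L, 0 ≤ t x) ∧ (∀ x, x ∉ Ioo (-L) L → t x ≤ 0) ∧
      (k^2 * (∫ x in (-L)..L, t x ^ 2) + ∫ x in (-L)..L, t' x ^ 2) = k^2 * ∫ x in (-L)..L, t x ∧
      2 * L - 2 / k ≤ ∫ x in (-L)..L, t x := by
  set c := Real.cosh (k * L) with hc
  have hcp : 0 < c := Real.cosh_pos _
  have e : ∀ x, HasDerivAt (fun x => k * x) k x := fun x => by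
    simpa using (hasDerivAt_id x).const_mul k
  have d1 : ∀ x, HasDerivAt (fun x => 1 - Real.cosh (k * x) / c) (-(k * Real.sinh (k*x) / c)) x := by
    intro x
    convert! (((Real.hasDerivAt_cosh _).comp x (e x)).div_const c).const_sub 1 using 1
    ring
  have d2 : ∀ x, HasDerivAt (fun x => -(k * Real.sinh (k*x) / c)) (-(k^2 * Real.cosh (k*x) / c)) x := by
    intro x
    convert! ((((Real.hasDerivAt_sinh _).comp x (e x)).const_mul k).div_const c).neg using 1
    ring
  have d3 : ∀ x, HasDerivAt (fun x => x - Real.sinh (k*x) / (k * c)) (1 - Real.cosh (k * x) / c) x := by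
    intro x
    convert! (hasDerivAt_id x).sub (((Real.hasDerivAt_sinh _).comp x (e x)).div_const (k*c)) using 1
    field_simp
  have c1 : Continuous fun x => 1 - Real.cosh (k * x) / c := by fun_prop
  have c2 : Continuous fun x => -(k * Real.sinh (k*x) / c) := by fun_prop
  refine ⟨fun x => 1 - Real.cosh (k * x) / c, fun x => -(k * Real.sinh (k*x) / c), d1, c2,
    ?_, ?_, ?_, ?_⟩
  · intro x hx
    have : Real.cosh (k * x) ≤ c := by
      rw [hc, Real.cosh_le_cosh, abs_mul, abs_mul, abs_of_pos hL]
      exact mul_le_mul_of_nonneg_left (abs_le.2 hx) (abs_nonneg _)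
    have := (div_le_one hcp).2 this
    simp only
    linarith
  · intro x hx
    have h : L ≤ |x| := by
      by_contra h
      exact hx (abs_lt.1 (not_le.1 h))
    have : c ≤ Real.cosh (k * x) := by
      rw [hc, Real.cosh_le_cosh, abs_mul, abs_mul, abs_of_pos hL]
      exact mul_le_mul_of_nonneg_left h (abs_nonneg _)
    have := (one_le_div hcp).2 this
    simp only
    linarith
  · have h := intervalIntegral.integral_eq_sub_of_hasDerivAt (a := -L) (b := L)
      (fun x _ => (d1 x).mul (d2 x)) (Continuous.intervalIntegrable (by fun_prop) _ _)
    have hr : ∀ x, (-(k * Real.sinh (k*x) / c)) * (-(k * Real.sinh (k*x) / c)) +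
       (1 - Real.cosh (k * x) / c) * (-(k^2 * Real.cosh (k*x) / c)) =
       (k^2 * (1 - Real.cosh (k * x) / c)^2 + (-(k * Real.sinh (k*x) / c))^2) -
        k^2 * (1 - Real.cosh (k * x) / c) := by intro x; ring
    simp only [hr] at h
    rw [intervalIntegral.integral_sub (Continuous.intervalIntegrable (by fun_prop) _ _)
      (Continuous.intervalIntegrable (by fun_prop) _ _), intervalIntegral.integral_add
      (Continuous.intervalIntegrable (by fun_prop) _ _)
      (Continuous.intervalIntegrable (by fun_prop) _ _), intervalIntegral.integral_const_mul,
      intervalIntegral.integral_const_mul] at h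
    have hcc : c / c = 1 := div_self hcp.ne'
    simp [← hc, hcc] at h
    simp only [neg_sq] at h ⊢
    linarith
  · rw [intervalIntegral.integral_eq_sub_of_hasDerivAt 
      (fun x _ => d3 x) (Continuous.intervalIntegrable (by fun_prop) _ _)]
    have hs : Real.sinh (k * L) / (k * c) ≤ 1 / k := by
      rw [div_le_div_iff₀ (by positivity) hk]
      have := (Real.sinh_lt_cosh (k * L)).le
      nlinarith
    simp [neg_div]
    have : 2 / k = 2 * (1 / k) := by ring
    linarith

lemma aux_prodint (f g : ℝ → ℝ) :
    ∫ x : EuclideanSpace ℝ (Fin 2), f (x 0) * g (x 1) = (∫ s, f s) * ∫ s, g s := by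
  have h := (EuclideanSpace.volume_preserving_symm_measurableEquiv_toLp (Fin 2)).integral_comp'
    (g := fun y : Fin 2 → ℝ => f (y 0) * g (y 1))
  have h2 := integral_fintype_prod_volume_eq_prod (ι := Fin 2) (E := fun _ => ℝ) (![f, g])
  simp only [Fin.prod_univ_two, Matrix.cons_val_zero, Matrix.cons_val_one] at h2
  rw [← h2, ← h]
  rfl

lemma aux_compact (f g : ℝ → ℝ) (hf : HasCompactSupport f) (hg : HasCompactSupport g) :
    HasCompactSupport (fun x : EuclideanSpace ℝ (Fin 2) => f (x 0) * g (x 1)) := by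
  have hK : IsCompact (Set.image (EuclideanSpace.equiv (Fin 2) ℝ).symm
      (Set.pi univ ![tsupport f, tsupport g])) := by
    refine IsCompact.image (isCompact_univ_pi ?_) (by fun_prop)
    intro i
    fin_cases i
    · exact hf
    · exact hg
  refine HasCompactSupport.intro hK ?_
  intro x hx
  by_contra h
  apply hx
  refine ⟨EuclideanSpace.equiv (Fin 2) ℝ x, ?_, by simp⟩
  intro i _
  fin_cases i
  · exact subset_tsupport f (left_ne_zero_of_mul h)
  · exact subset_tsupport g (right_ne_zero_of_mul h)

lemma aux_energy (F F' G G' : ℝ → ℝ) (hF : ∀ x, HasDerivAt F (F' x) x) (hF' : Continuous F')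
    (hG : ∀ x, HasDerivAt G (G' x) x) (hG' : Continuous G')
    (cF : HasCompactSupport F) (cF' : HasCompactSupport F')
    (cG : HasCompactSupport G) (cG' : HasCompactSupport G') :
    let u : EuclideanSpace ℝ (Fin 2) → ℝ := fun x => F (x 0) * G (x 1)
    ContDiff ℝ 1 u ∧ HasCompactSupport u ∧ tsupport u ⊆ {x | x 0 ∈ tsupport F ∧ x 1 ∈ tsupport G} ∧
    ∫ x, (‖fderiv ℝ u x‖ ^ 2 / 2 - u x) ≤
      ((∫ x, F x ^ 2) * (∫ x, G' x ^ 2) + (∫ x, F' x ^ 2) * (∫ x, G x ^ 2)) / 2 -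
        (∫ x, F x) * (∫ x, G x) := by
  intro u
  have Fc : Continuous F := continuous_iff_continuousAt.2 fun x => (hF x).continuousAt
  have Gc : Continuous G := continuous_iff_continuousAt.2 fun x => (hG x).continuousAt
  have F1 : ContDiff ℝ 1 F := by
    rw [contDiff_one_iff_deriv]
    exact ⟨fun x => (hF x).differentiableAt, by rwa [show deriv F = F' from funext fun x => (hF x).deriv]⟩
  have G1 : ContDiff ℝ 1 G := by
    rw [contDiff_one_iff_deriv]
    exact ⟨fun x => (hG x).differentiableAt, by rwa [show deriv G = G' from funext fun x => (hG x).deriv]⟩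
  have hu : ContDiff ℝ 1 u := by
    have p0 : ContDiff ℝ 1 (fun x : EuclideanSpace ℝ (Fin 2) => x 0) :=
      (EuclideanSpace.proj (𝕜 := ℝ) (0 : Fin 2)).contDiff
    have p1 : ContDiff ℝ 1 (fun x : EuclideanSpace ℝ (Fin 2) => x 1) :=
      (EuclideanSpace.proj (𝕜 := ℝ) (1 : Fin 2)).contDiff
    exact (F1.comp p0).mul (G1.comp p1)
  have cu : HasCompactSupport u := aux_compact F G cF cG
  refine ⟨hu, cu, ?_, ?_⟩
  · apply closure_minimal
    · intro x hx
      exact ⟨subset_tsupport F (left_ne_zero_of_mul hx), subset_tsupport G (right_ne_zero_of_mul hx)⟩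
    · exact ((isClosed_tsupport F).preimage (by fun_prop : Continuous fun x : EuclideanSpace ℝ (Fin 2) => x 0)).inter
        ((isClosed_tsupport G).preimage (by fun_prop : Continuous fun x : EuclideanSpace ℝ (Fin 2) => x 1))
  · have hd : ∀ x, ‖fderiv ℝ u x‖ ^ 2 ≤ F (x 0) ^ 2 * G' (x 1) ^ 2 + F' (x 0) ^ 2 * G (x 1) ^ 2 := by
      intro x
      have p0 : HasFDerivAt (fun x : EuclideanSpace ℝ (Fin 2) => x 0) (EuclideanSpace.proj (𝕜 := ℝ) (0 : Fin 2)) x :=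
        (EuclideanSpace.proj (𝕜 := ℝ) (0 : Fin 2)).hasFDerivAt
      have p1 : HasFDerivAt (fun x : EuclideanSpace ℝ (Fin 2) => x 1) (EuclideanSpace.proj (𝕜 := ℝ) (1 : Fin 2)) x :=
        (EuclideanSpace.proj (𝕜 := ℝ) (1 : Fin 2)).hasFDerivAt
      have h := ((hF (x 0)).comp_hasFDerivAt x p0).mul ((hG (x 1)).comp_hasFDerivAt x p1)
      have h' : fderiv ℝ u x = _ := h.fderiv
      have hn : ‖fderiv ℝ u x‖ ≤ √(F (x 0) ^ 2 * G' (x 1) ^ 2 + F' (x 0) ^ 2 * G (x 1) ^ 2) := by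
        refine ContinuousLinearMap.opNorm_le_bound _ (Real.sqrt_nonneg _) ?_
        intro v
        rw [h', EuclideanSpace.norm_eq, ← Real.sqrt_mul (by positivity), Real.norm_eq_abs]
        apply Real.abs_le_sqrt
        simp [Fin.sum_univ_two]
        nlinarith [sq_nonneg (F (x 0) * G' (x 1) * v 0 - F' (x 0) * G (x 1) * v 1)]
      calc _ ≤ _ := pow_le_pow_left₀ (norm_nonneg _) hn 2
        _ = _ := Real.sq_sqrt (by positivity)
    have csq : ∀ H : ℝ → ℝ, HasCompactSupport H → HasCompactSupport (fun x => H x ^ 2) := fun H h =>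
      h.comp_left (g := fun t : ℝ => t ^ 2) (by simp)
    have iu : Integrable u := hu.continuous.integrable_of_hasCompactSupport cu
    have i1 : Integrable (fun x : EuclideanSpace ℝ (Fin 2) => F (x 0) ^ 2 * G' (x 1) ^ 2) :=
      Continuous.integrable_of_hasCompactSupport (by fun_prop)
        (aux_compact (fun t => F t ^ 2) (fun t => G' t ^ 2) (csq F cF) (csq G' cG'))
    have i2 : Integrable (fun x : EuclideanSpace ℝ (Fin 2) => F' (x 0) ^ 2 * G (x 1) ^ 2) :=
      Continuous.integrable_of_hasCompactSupport (by fun_prop)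
        (aux_compact (fun t => F' t ^ 2) (fun t => G t ^ 2) (csq F' cF') (csq G cG))
    have i3 : Integrable (fun x => ‖fderiv ℝ u x‖ ^ 2 / 2) := by
      have hcd : Continuous (fderiv ℝ u) := hu.continuous_fderiv one_ne_zero
      apply Continuous.integrable_of_hasCompactSupport (by fun_prop)
      exact (cu.fderiv ℝ).comp_left (g := fun t => ‖t‖ ^ 2 / 2) (by simp)
    calc _ ≤ ∫ x, ((F (x 0) ^ 2 * G' (x 1) ^ 2 + F' (x 0) ^ 2 * G (x 1) ^ 2) / 2 - u x) := by
          apply integral_mono (i3.sub iu) (((i1.add i2).div_const 2).sub iu)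
          intro x
          have := hd x
          simp only [Pi.sub_apply, Pi.add_apply]
          linarith
      _ = _ := by
          have i12 : Integrable (fun x : EuclideanSpace ℝ (Fin 2) =>
              (F (x 0) ^ 2 * G' (x 1) ^ 2 + F' (x 0) ^ 2 * G (x 1) ^ 2) / 2) := (i1.add i2).div_const 2
          rw [integral_sub i12 iu, integral_div, integral_add i1 i2,
            aux_prodint (fun t => F t ^ 2) (fun t => G' t ^ 2),
            aux_prodint (fun t => F' t ^ 2) (fun t => G t ^ 2), aux_prodint F G]

lemma aux_bdd (a b : ℝ) (ha : 0 < a) (hab : a ≤ b) (u : EuclideanSpace ℝ (Fin 2) → ℝ)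
    (hu : ContDiff ℝ 1 u) (cu : HasCompactSupport u)
    (su : tsupport u ⊆ {x : EuclideanSpace ℝ (Fin 2) |
        x 0 ∈ Ioo (-(b / 2)) (b / 2) ∧ x 1 ∈ Ioo (-(a / 2)) (a / 2)}) :
    ∫ x, (closedBall (0 : EuclideanSpace ℝ (Fin 2)) (a + b)).indicator (fun _ => -(a^2/8)) x ≤
      ∫ x, (‖fderiv ℝ u x‖ ^ 2 / 2 - u x) := by
  have hcd : Continuous (fderiv ℝ u) := hu.continuous_fderiv one_ne_zero
  have iu : Integrable u := hu.continuous.integrable_of_hasCompactSupport cu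
  have i3 : Integrable (fun x => ‖fderiv ℝ u x‖ ^ 2 / 2) := by
    apply Continuous.integrable_of_hasCompactSupport (by fun_prop)
    exact (cu.fderiv ℝ).comp_left (g := fun t => ‖t‖ ^ 2 / 2) (by simp)
  let v : EuclideanSpace ℝ (Fin 2) := EuclideanSpace.single 1 1
  have hv : ‖v‖ = 1 := by simp [v]
  have fd : ∀ x, fderiv ℝ (fun x : EuclideanSpace ℝ (Fin 2) => x 1) x v = 1 := by
    intro x
    have p1 : HasFDerivAt (fun x : EuclideanSpace ℝ (Fin 2) => x 1) (EuclideanSpace.proj (𝕜 := ℝ) (1 : Fin 2)) x :=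
        (EuclideanSpace.proj (𝕜 := ℝ) (1 : Fin 2)).hasFDerivAt
    rw [p1.fderiv]
    simp [v]
  have i4 : Integrable (fun x : EuclideanSpace ℝ (Fin 2) => x 1 * fderiv ℝ u x v) := by
    apply Continuous.integrable_of_hasCompactSupport (by fun_prop)
    exact ((cu.fderiv ℝ).comp_left (g := fun t => t v) (by simp)).mul_left
  have ibp := integral_mul_fderiv_eq_neg_fderiv_mul_of_integrable (μ := volume)
    (f := fun x : EuclideanSpace ℝ (Fin 2) => x 1) (g := u) (v := v)
    (by simpa only [fd, one_mul] using iu) i4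
    (by
      apply Continuous.integrable_of_hasCompactSupport
      · have := hu.continuous
        fun_prop
      · exact cu.mul_left)
    (fun x _ => (EuclideanSpace.proj (𝕜 := ℝ) (1 : Fin 2)).differentiableAt)
    (fun x _ => (hu.differentiable one_ne_zero) x)
  simp only [fd, one_mul] at ibp
  have hE : ∫ x, (‖fderiv ℝ u x‖ ^ 2 / 2 - u x) =
      ∫ x, (‖fderiv ℝ u x‖ ^ 2 / 2 + x 1 * fderiv ℝ u x v) := by
    rw [integral_sub i3 iu, integral_add i3 i4, ibp]
    ring
  rw [hE]
  apply integral_mono _ (i3.add i4)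
  · intro x
    by_cases hx : x ∈ tsupport u
    · obtain ⟨⟨h1, h2⟩, h3, h4⟩ := su hx
      have hle : (closedBall (0 : EuclideanSpace ℝ (Fin 2)) (a + b)).indicator (fun _ => -(a^2/8)) x = -(a^2/8) := by
        apply indicator_of_mem
        rw [mem_closedBall_zero_iff, EuclideanSpace.norm_eq]
        apply Real.sqrt_le_iff.2 ⟨by linarith, ?_⟩
        simp [Fin.sum_univ_two]
        have := sq_le_sq' h1.le h2.le
        have := sq_le_sq' h3.le h4.le
        nlinarith
      simp only [Pi.add_apply]
      rw [hle]
      have hn : |fderiv ℝ u x v| ≤ ‖fderiv ℝ u x‖ := by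
        simpa [hv] using (fderiv ℝ u x).le_opNorm v
      have hs : (fderiv ℝ u x v) ^ 2 ≤ ‖fderiv ℝ u x‖ ^ 2 := by
        rw [← sq_abs]
        exact pow_le_pow_left₀ (abs_nonneg _) hn 2
      have := sq_le_sq' h3.le h4.le
      nlinarith [sq_nonneg (x 1 + fderiv ℝ u x v)]
    · have h0 : fderiv ℝ u x = 0 := by
        by_contra h
        exact hx (support_fderiv_subset ℝ h)
      simp only [Pi.add_apply, h0]
      simp
      apply indicator_nonpos
      intro y _
      have := sq_nonneg a
      linarith
  · exact (integrable_indicator_iff measurableSet_closedBall).2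
      (integrableOn_const measure_closedBall_lt_top.ne)

theorem torsion_rectangle_lower_bound (a b : ℝ) (ha : 0 < a) (hab : a ≤ b) :
    torsionalRigidity {x : EuclideanSpace ℝ (Fin 2) |
        x 0 ∈ Ioo (-(b / 2)) (b / 2) ∧ x 1 ∈ Ioo (-(a / 2)) (a / 2)} ≥
      a ^ 3 * b / 12 - 11 * a ^ 4 / 180 := by
  have hb : 0 < b := lt_of_lt_of_le ha hab
  set k := √10 / a with hk
  have hk0 : 0 < k := by positivity
  have hk2 : k ^ 2 * (a ^ 5 / 120) = a ^ 3 / 12 := by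
    rw [hk, div_pow, Real.sq_sqrt (by norm_num)]
    field_simp
    norm_num
  have hk3 : 2 / k ≤ 2 * a / 3 := by
    have : (3 : ℝ) ≤ √10 := Real.le_sqrt_of_sq_le (by norm_num)
    rw [hk, div_div_eq_mul_div]
    exact div_le_div_of_nonneg_left (by positivity) (by norm_num) this
  obtain ⟨t, t', ht, ht', tin, tout, tE, tI⟩ := aux_cosh k (b / 2) hk0 (by positivity)
  obtain ⟨q1, q2, q3⟩ := aux_quad a
  set I := ∫ x in (-(b/2))..(b/2), t x with hI
  have hI0 : 0 < I := by linarith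
  set A := a ^ 3 / 12 with hA
  have hA0 : 0 < A := by positivity
  obtain ⟨δ, hδ, hδ1, hδ2, hδ3⟩ : ∃ δ : ℝ, 0 < δ ∧ 2 * a * δ ≤ A ∧ 2 * b * δ ≤ I ∧
      4 * δ * (a * I + A * b) ≤ A * (a / 15) := by
    refine ⟨min (A / (2 * a)) (min (I / (2 * b)) (A * (a / 15) / (4 * (a * I + A * b)))),
      by positivity, ?_, ?_, ?_⟩
    · have := min_le_left (A / (2 * a)) (min (I / (2 * b)) (A * (a / 15) / (4 * (a * I + A * b))))
      rw [le_div_iff₀ (by positivity)] at this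
      linarith
    · have := (min_le_right (A / (2 * a)) (min (I / (2 * b)) (A * (a / 15) / (4 * (a * I + A * b))))).trans (min_le_left _ _)
      rw [le_div_iff₀ (by positivity)] at this
      linarith
    · have := (min_le_right (A / (2 * a)) (min (I / (2 * b)) (A * (a / 15) / (4 * (a * I + A * b))))).trans (min_le_right _ _)
      rw [le_div_iff₀ (by positivity)] at this
      linarith
  obtain ⟨F, F', hF, hF', cF, cF', sF, F1, F2, F3⟩ :=
    aux_cutoff t t' (b / 2) δ (by positivity) hδ ht ht' tin tout
  obtain ⟨G, G', hG, hG', cG, cG', sG, G1, G2, G3⟩ :=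
    aux_cutoff (fun y => (a^2 - 4*y^2)/8) (fun y => -y) (a / 2) δ (by positivity) hδ
    (by
      intro x
      convert! ((((hasDerivAt_id x).pow 2).const_mul 4).const_sub (a^2)).div_const 8 using 1
      simp; ring)
    (by fun_prop)
    (by
      intro x hx
      have := sq_le_sq' hx.1 hx.2
      linarith)
    (by
      intro x hx
      have h : a / 2 ≤ |x| := by
        by_contra h
        exact hx (abs_lt.1 (not_le.1 h))
      have := pow_le_pow_left₀ (by positivity) h 2
      rw [sq_abs] at this
      linarith)
  rw [q2] at G1
  rw [q3] at G2
  rw [q1] at G3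
  rw [← hI] at F3
  obtain ⟨e1, e2, e3, e4⟩ := aux_energy F F' G G' hF hF' hG hG' cF cF' cG cG'
  have hmain := e4
  have p1 : (∫ x, F x ^ 2) * (∫ x, G' x ^ 2) ≤ (∫ x in (-(b/2))..(b/2), t x ^ 2) * A :=
    mul_le_mul F1 G2 (integral_nonneg fun x => sq_nonneg _)
      ((integral_nonneg fun x => sq_nonneg _).trans F1)
  have p2 : (∫ x, F' x ^ 2) * (∫ x, G x ^ 2) ≤ (∫ x in (-(b/2))..(b/2), t' x ^ 2) * (a^5/120) :=
    mul_le_mul F2 G1 (integral_nonneg fun x => sq_nonneg _)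
      ((integral_nonneg fun x => sq_nonneg _).trans F2)
  have p3 : (I - 2 * b * δ) * (A - 2 * a * δ) ≤ (∫ x, F x) * (∫ x, G x) :=
    mul_le_mul (by linarith) (by linarith) (by linarith) (by linarith)
  have p4 : (∫ x in (-(b/2))..(b/2), t x ^ 2) * A + (∫ x in (-(b/2))..(b/2), t' x ^ 2) * (a^5/120)
      = A * I := by
    have := congrArg (fun z => z * (a^5/120)) tE
    linear_combination this + (I - (∫ x in (-(b/2))..(b/2), t x ^ 2)) * hk2
  unfold torsionalRigidity
  have hinf := csInf_le (s := {r : ℝ | ∃ u : EuclideanSpace ℝ (Fin 2) → ℝ, ContDiff ℝ 1 u ∧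
      HasCompactSupport u ∧ tsupport u ⊆ {x : EuclideanSpace ℝ (Fin 2) |
        x 0 ∈ Ioo (-(b / 2)) (b / 2) ∧ x 1 ∈ Ioo (-(a / 2)) (a / 2)} ∧
      r = ∫ x, (‖fderiv ℝ u x‖ ^ 2 / 2 - u x)})
    ⟨_, by
      rintro r ⟨u, h1, h2, h3, rfl⟩
      exact aux_bdd a b ha hab u h1 h2 h3⟩
    ⟨_, e1, e2, fun x hx => ⟨sF (e3 hx).1, sG (e3 hx).2⟩, rfl⟩
  have hAI : A * (b - 2 * a / 3) ≤ A * I := mul_le_mul_of_nonneg_left (by linarith) hA0.le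
  have hfin : a ^ 3 * b / 12 - 11 * a ^ 4 / 180 = A * (b - 2 * a / 3) - A * (a / 15) := by
    rw [hA]; ring
  rw [hfin]
  have hpos : 0 ≤ a * b * δ ^ 2 := by positivity
  have := hinf.trans hmain
  nlinarith
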